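/- Let d ≥ 1, R ∈ (0,∞), and let 𝒪_R := {x ∈ ℝ^d : |x| > R}. Let V : 𝒪_R → ℝ be bounded and measurable with V(x) → 0 as |x| → ∞. For E ≤ 0 define ν_𝒩(E;V) as the supremum of dimensions of finite-dimensional subspaces F of {u|_{𝒪_R} : u ∈ C_c^∞(ℝ^d;ℝ)} such that every nonzero v ∈ F satisfies ∫_{𝒪_R}(|∇v|² - E v² + V v²)dx < 0, and define ν_𝒟(E;V) analogously with F ranging over finite-dimensional subspaces of C_c^∞(𝒪_R;ℝ). Then for each ε ∈ (0,1) there exist a constant C ∈ (0,∞) and E₀ < 0 such that ν_𝒩(E;V) ≤ ν_𝒟(E;(1-ε)^{-1}V) + C for all E ∈ (E₀, 0). -/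

import Mathlib

open MeasureTheory Filter Real Set Topology

noncomputable section

abbrev Ed (d : ℕ) := EuclideanSpace ℝ (Fin d)

/-- Variational (Glazman) count of negative eigenvalues of the shifted Neumann realization of
`-Δ + V` on the exterior domain `𝒪_R = {|x| > R}`, computed over restrictions to `𝒪_R` of
compactly supported smooth functions on `ℝ^d`. -/
noncomputable def nuNeu (d : ℕ) (R : ℝ) (V : Ed d → ℝ) (E : ℝ) : ℕ∞ :=
  ⨆ F : {F : Submodule ℝ ({x : Ed d // R < ‖x‖} → ℝ) //
      (∀ v ∈ F, ∃ u : Ed d → ℝ, ContDiff ℝ (⊤ : ℕ∞) u ∧ HasCompactSupport u ∧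
        ∀ x : {x : Ed d // R < ‖x‖}, v x = u x.1) ∧
      (∀ v ∈ F, v ≠ 0 → ∀ u : Ed d → ℝ, ContDiff ℝ (⊤ : ℕ∞) u → HasCompactSupport u →
        (∀ x : {x : Ed d // R < ‖x‖}, v x = u x.1) →
        (∫ x in {x : Ed d | R < ‖x‖},
          (‖gradient u x‖ ^ 2 - E * u x ^ 2 + V x * u x ^ 2)) < 0)},
    (Module.finrank ℝ F.1 : ℕ∞)

/-- Variational (Glazman) count of negative eigenvalues of the shifted Dirichlet realization of
`-Δ + V` on the exterior domain `𝒪_R = {|x| > R}`, computed over smooth functions compactly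
supported inside `𝒪_R`. -/
noncomputable def nuDir (d : ℕ) (R : ℝ) (V : Ed d → ℝ) (E : ℝ) : ℕ∞ :=
  ⨆ F : {F : Submodule ℝ (Ed d → ℝ) //
      (∀ u ∈ F, ContDiff ℝ (⊤ : ℕ∞) u ∧ HasCompactSupport u ∧
        tsupport u ⊆ {x : Ed d | R < ‖x‖}) ∧
      (∀ u ∈ F, u ≠ 0 →
        (∫ x in {x : Ed d | R < ‖x‖},
          (‖gradient u x‖ ^ 2 - E * u x ^ 2 + V x * u x ^ 2)) < 0)},
    (Module.finrank ℝ F.1 : ℕ∞)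


lemma integrable_sq_aux {d : ℕ} (u : Ed d → ℝ) (hc : Continuous u) (hcs : HasCompactSupport u) :
    Integrable (fun x => u x ^ 2) := by
  have h : HasCompactSupport (fun x => u x ^ 2) := by
    refine hcs.mono ?_
    intro x hx
    simp only [Function.mem_support, ne_eq] at hx ⊢
    intro h
    simp [h] at hx
  exact Continuous.integrable_of_hasCompactSupport (by fun_prop) h

lemma integrable_fderiv_sq_aux {d : ℕ} (u : Ed d → ℝ) (hu : ContDiff ℝ 1 u)
    (hcs : HasCompactSupport u) : Integrable (fun x => ‖fderiv ℝ u x‖ ^ 2) := by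
  have hcf : Continuous (fderiv ℝ u) := hu.continuous_fderiv (by norm_num)
  have h : HasCompactSupport (fun x => ‖fderiv ℝ u x‖ ^ 2) := by
    refine (hcs.fderiv ℝ).mono ?_
    intro x hx
    simp only [Function.mem_support, ne_eq] at hx ⊢
    intro h
    simp [h] at hx
  exact Continuous.integrable_of_hasCompactSupport (by fun_prop) h

lemma sq_integral_le_aux (h : ℝ → ℝ) (hc : Continuous h) :
    (∫ t in (0:ℝ)..1, h t) ^ 2 ≤ ∫ t in (0:ℝ)..1, h t ^ 2 := by
  set m := ∫ t in (0:ℝ)..1, h t with hm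
  have h0 : 0 ≤ ∫ t in (0:ℝ)..1, (h t - m) ^ 2 :=
    intervalIntegral.integral_nonneg (by norm_num) (fun t _ => sq_nonneg _)
  have h1 : ∫ t in (0:ℝ)..1, (h t - m) ^ 2
      = (∫ t in (0:ℝ)..1, h t ^ 2) - 2 * m * m + m ^ 2 := by
    have e : ∀ t, (h t - m) ^ 2 = (h t ^ 2 - 2 * m * h t) + m ^ 2 := fun t => by ring
    simp_rw [e]
    have i1 : IntervalIntegrable (fun t => h t ^ 2) volume 0 1 :=
      (hc.pow 2).intervalIntegrable _ _
    have i2 : IntervalIntegrable (fun t => 2 * m * h t) volume 0 1 :=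
      (continuous_const.mul hc).intervalIntegrable _ _
    rw [intervalIntegral.integral_add (i1.sub i2) (by simp),
      intervalIntegral.integral_sub i1 i2, intervalIntegral.integral_const_mul]
    simp [hm]
  nlinarith

lemma diff_sq_le {d : ℕ} (u : Ed d → ℝ) (hu : ContDiff ℝ 1 u) (x w : Ed d) :
    ENNReal.ofReal ((u x - u (x + w)) ^ 2) ≤
      ∫⁻ t in Ioc (0:ℝ) 1, ENNReal.ofReal (‖w‖ ^ 2 * ‖fderiv ℝ u (x + t • w)‖ ^ 2) := by
  have hcf : Continuous (fderiv ℝ u) := hu.continuous_fderiv (by norm_num)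
  have hl : Continuous fun t : ℝ => x + t • w := by fun_prop
  have hc1 : Continuous fun t : ℝ => fderiv ℝ u (x + t • w) := hcf.comp hl
  have hc : Continuous fun t : ℝ => fderiv ℝ u (x + t • w) w := hc1.clm_apply continuous_const
  have hder : ∀ t ∈ uIcc (0:ℝ) 1,
      HasDerivAt (fun t : ℝ => u (x + t • w)) (fderiv ℝ u (x + t • w) w) t := by
    intro t _
    have h1 : HasFDerivAt u (fderiv ℝ u (x + t • w)) (x + t • w) :=
      (hu.differentiable (by norm_num) _).hasFDerivAt
    have h2 : HasDerivAt (fun t : ℝ => x + t • w) w t := by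
      simpa using ((hasDerivAt_id t).smul_const w).const_add x
    exact h1.comp_hasDerivAt t h2
  have hftc := intervalIntegral.integral_eq_sub_of_hasDerivAt hder (hc.intervalIntegrable _ _)
  simp only [one_smul, zero_smul, add_zero] at hftc
  have h1 := sq_integral_le_aux _ hc
  rw [hftc] at h1
  have h2 : ∫ t in (0:ℝ)..1, (fderiv ℝ u (x + t • w) w) ^ 2 ≤
      ∫ t in (0:ℝ)..1, ‖w‖ ^ 2 * ‖fderiv ℝ u (x + t • w)‖ ^ 2 := by
    apply intervalIntegral.integral_mono_on (by norm_num) ((hc.pow 2).intervalIntegrable _ _)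
      ((continuous_const.mul (hc1.norm.pow 2)).intervalIntegrable _ _)
    intro t _
    change (fderiv ℝ u (x + t • w) w) ^ 2 ≤ ‖w‖ ^ 2 * ‖fderiv ℝ u (x + t • w)‖ ^ 2
    have := (fderiv ℝ u (x + t • w)).le_opNorm w
    rw [← sq_abs, ← Real.norm_eq_abs, ← mul_pow, mul_comm ‖w‖]
    gcongr
  have hi : Continuous fun t : ℝ => ‖w‖ ^ 2 * ‖fderiv ℝ u (x + t • w)‖ ^ 2 := by fun_prop
  rw [← ofReal_integral_eq_lintegral_ofReal ((hi.intervalIntegrable (μ := volume) 0 1).1)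
    (Eventually.of_forall fun t => by positivity)]
  rw [← intervalIntegral.integral_of_le (by norm_num)]
  apply ENNReal.ofReal_le_ofReal
  nlinarith

lemma lintegral_affine_le {d : ℕ} (g : Ed d → ENNReal) (hg : Measurable g) (a : ℝ) (ha : 1 ≤ a)
    (b : Ed d) : ∫⁻ x, g (a • x + b) ≤ ∫⁻ x, g x := by
  have h1 : ∫⁻ x, g (a • x + b) = ∫⁻ y, g (y + b) ∂(Measure.map (fun x : Ed d => a • x) volume) := by
    rw [lintegral_map (by fun_prop) (by fun_prop)]
  rw [h1, Measure.map_addHaar_smul volume (by positivity : a ≠ 0), lintegral_smul_measure,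
    lintegral_add_right_eq_self (fun y => g y) b]
  have : ENNReal.ofReal |(a ^ Module.finrank ℝ (Ed d))⁻¹| ≤ 1 := by
    rw [ENNReal.ofReal_le_one, abs_of_nonneg (by positivity)]
    exact inv_le_one_of_one_le₀ (one_le_pow₀ ha)
  simpa using mul_le_mul_left this (∫⁻ x, g x)

lemma shift_le {d : ℕ} (u : Ed d → ℝ) (hu : ContDiff ℝ 1 u) (R s : ℝ) (hs : 0 < s)
    (z : Ed d) (hz : ‖z‖ ≤ s * R) :
    ∫⁻ x in {x : Ed d | R < ‖x‖ ∧ ‖x‖ ≤ 2 * R},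
      ENNReal.ofReal ((u x - u ((1 + s) • x + z)) ^ 2) ≤
    ENNReal.ofReal ((3 * s * R) ^ 2) *
      ∫⁻ x in {x : Ed d | R < ‖x‖}, ENNReal.ofReal (‖fderiv ℝ u x‖ ^ 2) := by
  have hcf : Continuous (fderiv ℝ u) := hu.continuous_fderiv (by norm_num)
  have hme : MeasurableSet {x : Ed d | R < ‖x‖} := measurableSet_lt measurable_const measurable_norm
  have hmo : MeasurableSet {x : Ed d | R < ‖x‖ ∧ ‖x‖ ≤ 2 * R} :=
    hme.inter (measurableSet_le measurable_norm measurable_const)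
  set g : Ed d → ENNReal := indicator {x : Ed d | R < ‖x‖}
    (fun x => ENNReal.ofReal (‖fderiv ℝ u x‖ ^ 2)) with hg
  have hgm : Measurable g := Measurable.indicator (by fun_prop) hme
  have hgi : ∫⁻ x in {x : Ed d | R < ‖x‖}, ENNReal.ofReal (‖fderiv ℝ u x‖ ^ 2) = ∫⁻ x, g x :=
    (lintegral_indicator hme _).symm
  rw [hgi]
  calc ∫⁻ x in {x : Ed d | R < ‖x‖ ∧ ‖x‖ ≤ 2 * R},
      ENNReal.ofReal ((u x - u ((1 + s) • x + z)) ^ 2)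
      ≤ ∫⁻ x in {x : Ed d | R < ‖x‖ ∧ ‖x‖ ≤ 2 * R}, ∫⁻ t in Ioc (0:ℝ) 1,
        ENNReal.ofReal ((3 * s * R) ^ 2) * g ((1 + t * s) • x + t • z) := by
        apply setLIntegral_mono' hmo
        intro x hx
        have e : (1 + s) • x + z = x + (s • x + z) := by module
        rw [e]
        refine (diff_sq_le u hu x _).trans ?_
        apply setLIntegral_mono' measurableSet_Ioc
        intro t ht
        have e2 : x + t • (s • x + z) = (1 + t * s) • x + t • z := by module
        rw [e2]
        have hmem : R < ‖(1 + t * s) • x + t • z‖ := by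
          have h1 := norm_sub_norm_le ((1 + t * s) • x) (-(t • z))
          rw [sub_neg_eq_add, norm_neg, norm_smul, norm_smul, Real.norm_eq_abs, Real.norm_eq_abs,
            abs_of_nonneg ht.1.le, abs_of_nonneg (by have := mul_pos ht.1 hs; linarith)] at h1
          have h2 : t * ‖z‖ ≤ t * (s * R) := mul_le_mul_of_nonneg_left hz ht.1.le
          have h3 : t * s * R ≤ t * s * ‖x‖ :=
            mul_le_mul_of_nonneg_left hx.1.le (mul_pos ht.1 hs).le
          have := hx.1
          nlinarith
        rw [hg, indicator_of_mem (by exact hmem), ENNReal.ofReal_mul (by positivity)]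
        gcongr
        calc ‖s • x + z‖ ≤ ‖s • x‖ + ‖z‖ := norm_add_le _ _
          _ ≤ s * (2 * R) + s * R := by
            rw [norm_smul, Real.norm_eq_abs, abs_of_pos hs]
            gcongr
            exact hx.2
          _ = 3 * s * R := by ring
    _ ≤ ∫⁻ x : Ed d, ∫⁻ t in Ioc (0:ℝ) 1,
        ENNReal.ofReal ((3 * s * R) ^ 2) * g ((1 + t * s) • x + t • z) :=
        setLIntegral_le_lintegral _ _
    _ = ∫⁻ t in Ioc (0:ℝ) 1, ∫⁻ x : Ed d, 
        ENNReal.ofReal ((3 * s * R) ^ 2) * g ((1 + t * s) • x + t • z) := by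
        apply lintegral_lintegral_swap
        apply Measurable.aemeasurable
        apply Measurable.const_mul
        apply hgm.comp
        apply Continuous.measurable
        fun_prop
    _ ≤ ∫⁻ t in Ioc (0:ℝ) 1, ENNReal.ofReal ((3 * s * R) ^ 2) * ∫⁻ x, g x := by
        apply setLIntegral_mono' measurableSet_Ioc
        intro t ht
        rw [lintegral_const_mul _ (by fun_prop)]
        refine mul_le_mul_right (lintegral_affine_le g hgm _ ?_ _) _
        have := mul_pos ht.1 hs
        linarith
    _ = _ := by simp

/-- Poincaré-type inequality on the shell, on a subspace of finite codimension. -/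
lemma shell_poincare (d : ℕ) (R η : ℝ) (hR : 0 < R) (hη : 0 < η) :
    ∃ r : ℝ, ∃ T : Finset (Ed d), ∀ u : Ed d → ℝ, ContDiff ℝ 1 u → HasCompactSupport u →
      (∀ c ∈ T, ∫ y in Metric.ball c r, u y = 0) →
      ∫ x in {x : Ed d | R < ‖x‖ ∧ ‖x‖ ≤ 2 * R}, u x ^ 2 ≤
        η * ∫ x in {x : Ed d | R < ‖x‖}, ‖fderiv ℝ u x‖ ^ 2 := by
  obtain ⟨s, hs, hsη⟩ : ∃ s : ℝ, 0 < s ∧ 2 ^ d * (3 * s * R) ^ 2 ≤ η := by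
    refine ⟨√(η / (2 ^ d * (3 * R) ^ 2)), by positivity, le_of_eq ?_⟩
    have : (3 * √(η / (2 ^ d * (3 * R) ^ 2)) * R) ^ 2 = (3 * R) ^ 2 * (η / (2 ^ d * (3 * R) ^ 2)) := by
      rw [← Real.sq_sqrt (by positivity : 0 ≤ η / (2 ^ d * (3 * R) ^ 2))]
      simp
      ring
    rw [this]
    field_simp
  have hr : 0 < s * R / 2 := by positivity
  obtain ⟨T, -, hT⟩ := (isCompact_closedBall (0 : Ed d) ((1 + s) * (2 * R))).elim_nhds_subcover
    (fun c => Metric.ball c (s * R / 2)) (fun c _ => Metric.ball_mem_nhds c hr)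
  refine ⟨s * R / 2, T, fun u hu hcs hz => ?_⟩
  have hme : MeasurableSet {x : Ed d | R < ‖x‖} := measurableSet_lt measurable_const measurable_norm
  have hmo : MeasurableSet {x : Ed d | R < ‖x‖ ∧ ‖x‖ ≤ 2 * R} :=
    hme.inter (measurableSet_le measurable_norm measurable_const)
  have hcu : Continuous u := hu.continuous
  have hcf : Continuous (fderiv ℝ u) := hu.continuous_fderiv (by norm_num)
  set β := (volume (Metric.ball (0 : Ed d) (s * R / 2))) with hβ
  have hβ0 : β ≠ 0 := (Metric.measure_ball_pos _ _ hr).ne'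
  have hβt : β ≠ ⊤ := measure_ball_lt_top.ne
  have hvol : volume (Metric.ball (0 : Ed d) (s * R)) = 2 ^ d * β := by
    have : s * R = 2 * (s * R / 2) := by ring
    rw [this, hβ, Measure.addHaar_ball_mul_of_pos _ _ (by norm_num)]
    simp [ENNReal.ofReal_pow]
  -- pointwise bound
  have hpt : ∀ x : Ed d, ‖x‖ ≤ 2 * R → β * ENNReal.ofReal (u x ^ 2) ≤
      ∫⁻ z in Metric.ball (0 : Ed d) (s * R), ENNReal.ofReal ((u x - u ((1 + s) • x + z)) ^ 2) := by
    intro x hx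
    have hx' : (1 + s) • x ∈ Metric.closedBall (0 : Ed d) ((1 + s) * (2 * R)) := by
      rw [mem_closedBall_zero_iff, norm_smul, Real.norm_eq_abs, abs_of_pos (by positivity)]
      gcongr
    obtain ⟨c, hcT, hxc⟩ := mem_iUnion₂.1 (hT hx')
    have hsub : Metric.ball c (s * R / 2) ⊆ Metric.ball ((1 + s) • x) (s * R) := by
      apply Metric.ball_subset_ball'
      rw [dist_comm]
      have := Metric.mem_ball.1 hxc
      linarith
    have h1 : ∫⁻ z in Metric.ball (0 : Ed d) (s * R),
        ENNReal.ofReal ((u x - u ((1 + s) • x + z)) ^ 2) =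
        ∫⁻ y in Metric.ball ((1 + s) • x) (s * R), ENNReal.ofReal ((u x - u y) ^ 2) := by
      rw [← lintegral_indicator measurableSet_ball, ← lintegral_indicator measurableSet_ball,
        ← lintegral_add_left_eq_self (indicator (Metric.ball ((1 + s) • x) (s * R)) _) ((1 + s) • x)]
      congr 1
      ext z
      by_cases hz : z ∈ Metric.ball (0 : Ed d) (s * R)
      · rw [indicator_of_mem hz, indicator_of_mem]
        simpa using hz
      · rw [indicator_of_notMem hz, indicator_of_notMem]
        simpa using hz
    rw [h1]
    refine le_trans ?_ (lintegral_mono_set hsub)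
    have iu : IntegrableOn u (Metric.ball c (s * R / 2)) :=
      (hcu.integrable_of_hasCompactSupport hcs).integrableOn
    have iu2 : IntegrableOn (fun y => u y ^ 2) (Metric.ball c (s * R / 2)) :=
      (integrable_sq_aux u hcu hcs).integrableOn
    have ic : IntegrableOn (fun _ : Ed d => u x ^ 2) (Metric.ball c (s * R / 2)) :=
      integrableOn_const measure_ball_lt_top.ne
    have e : ∀ y, (u x - u y) ^ 2 = (u x ^ 2 - 2 * u x * u y) + u y ^ 2 := fun y => by ring
    have ii : IntegrableOn (fun y => (u x - u y) ^ 2) (Metric.ball c (s * R / 2)) := by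
      simp_rw [e]
      exact (ic.sub (iu.const_mul _)).add iu2
    rw [← ofReal_integral_eq_lintegral_ofReal ii (Eventually.of_forall fun t => sq_nonneg _)]
    have h2 : ∫ y in Metric.ball c (s * R / 2), (u x - u y) ^ 2 =
        β.toReal * u x ^ 2 + ∫ y in Metric.ball c (s * R / 2), u y ^ 2 := by
      simp_rw [e]
      have im : IntegrableOn (fun y => 2 * u x * u y) (Metric.ball c (s * R / 2)) :=
        iu.const_mul _
      have is : IntegrableOn (fun y => u x ^ 2 - 2 * u x * u y) (Metric.ball c (s * R / 2)) :=
        ic.sub im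
      rw [integral_add is iu2, integral_sub ic im,
        integral_const_mul, hz c hcT]
      simp [Measure.real, hβ, Measure.addHaar_ball_center]
    rw [h2, ← ENNReal.ofReal_toReal hβt, ← ENNReal.ofReal_mul ENNReal.toReal_nonneg,
      ENNReal.toReal_ofReal ENNReal.toReal_nonneg]
    apply ENNReal.ofReal_le_ofReal
    have : 0 ≤ ∫ y in Metric.ball c (s * R / 2), u y ^ 2 :=
      integral_nonneg fun y => sq_nonneg _
    linarith
  have hint : β * ∫⁻ x in {x : Ed d | R < ‖x‖ ∧ ‖x‖ ≤ 2 * R}, ENNReal.ofReal (u x ^ 2) ≤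
      β * (2 ^ d * (ENNReal.ofReal ((3 * s * R) ^ 2) *
      ∫⁻ x in {x : Ed d | R < ‖x‖}, ENNReal.ofReal (‖fderiv ℝ u x‖ ^ 2))) := by
    calc β * ∫⁻ x in {x : Ed d | R < ‖x‖ ∧ ‖x‖ ≤ 2 * R}, ENNReal.ofReal (u x ^ 2)
        = ∫⁻ x in {x : Ed d | R < ‖x‖ ∧ ‖x‖ ≤ 2 * R}, β * ENNReal.ofReal (u x ^ 2) := by
          rw [lintegral_const_mul _ (by fun_prop)]
      _ ≤ ∫⁻ x in {x : Ed d | R < ‖x‖ ∧ ‖x‖ ≤ 2 * R}, ∫⁻ z in Metric.ball (0 : Ed d) (s * R),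
          ENNReal.ofReal ((u x - u ((1 + s) • x + z)) ^ 2) :=
          setLIntegral_mono' hmo fun x hx => hpt x hx.2
      _ = ∫⁻ z in Metric.ball (0 : Ed d) (s * R), ∫⁻ x in {x : Ed d | R < ‖x‖ ∧ ‖x‖ ≤ 2 * R}, 
          ENNReal.ofReal ((u x - u ((1 + s) • x + z)) ^ 2) := by
          apply lintegral_lintegral_swap
          apply Measurable.aemeasurable
          apply Measurable.ennreal_ofReal
          apply Continuous.measurable
          fun_prop
      _ ≤ ∫⁻ z in Metric.ball (0 : Ed d) (s * R), ENNReal.ofReal ((3 * s * R) ^ 2) *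
          ∫⁻ x in {x : Ed d | R < ‖x‖}, ENNReal.ofReal (‖fderiv ℝ u x‖ ^ 2) := by
          apply setLIntegral_mono' measurableSet_ball
          intro z hz
          exact shift_le u hu R s hs z (mem_ball_zero_iff.1 hz).le
      _ = _ := by
          rw [setLIntegral_const, hvol]
          ring
  have hint2 := (ENNReal.mul_le_mul_iff_right hβ0 hβt).1 hint
  have ig : IntegrableOn (fun x => ‖fderiv ℝ u x‖ ^ 2) {x : Ed d | R < ‖x‖} :=
    (integrable_fderiv_sq_aux u hu hcs).integrableOn
  have iu2 : IntegrableOn (fun y => u y ^ 2) {x : Ed d | R < ‖x‖ ∧ ‖x‖ ≤ 2 * R} :=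
      (integrable_sq_aux u hcu hcs).integrableOn
  rw [← ofReal_integral_eq_lintegral_ofReal ig (Eventually.of_forall fun t => by positivity),
    ← ofReal_integral_eq_lintegral_ofReal iu2 (Eventually.of_forall fun t => by positivity)] at hint2
  have hG : 0 ≤ ∫ x in {x : Ed d | R < ‖x‖}, ‖fderiv ℝ u x‖ ^ 2 :=
    integral_nonneg fun y => by positivity
  have e2 : (2 : ENNReal) ^ d = ENNReal.ofReal (2 ^ d) := by
    rw [ENNReal.ofReal_pow (by norm_num)]; simp
  rw [e2, ← ENNReal.ofReal_mul (by positivity), ← ENNReal.ofReal_mul (by positivity),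
    ENNReal.ofReal_le_ofReal_iff (by positivity)] at hint2
  refine hint2.trans ?_
  rw [← mul_assoc]
  gcongr

lemma norm_gradient_aux {d : ℕ} (u : Ed d → ℝ) (x : Ed d) : ‖gradient u x‖ = ‖fderiv ℝ u x‖ := by
  simp [gradient]

/-- integrability of the form density -/
lemma integrable_form_aux {d : ℕ} (u : Ed d → ℝ) (hu : ContDiff ℝ 1 u) (hcs : HasCompactSupport u)
    (V : Ed d → ℝ) (hVmeas : Measurable V) (M : ℝ) (hVbd : ∀ x, |V x| ≤ M) (E : ℝ) :
    Integrable (fun x => ‖gradient u x‖ ^ 2 - E * u x ^ 2 + V x * u x ^ 2) := by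
  have h2 := integrable_sq_aux u hu.continuous hcs
  have h1 := integrable_fderiv_sq_aux u hu hcs
  simp_rw [norm_gradient_aux]
  refine (h1.sub (h2.const_mul E)).add ?_
  exact h2.bdd_mul hVmeas.aestronglyMeasurable (Eventually.of_forall hVbd)

lemma pointwise_aux (ε K L M a b c X v E : ℝ) (w : ℝ) (hε : ε ∈ Set.Ioo (0:ℝ) 1)
    (hE : E < 0) (ha : 0 ≤ a) (hc : 0 ≤ c) (hcL : c ≤ L) (hX0 : 0 ≤ X) (hX1 : X ≤ 1)
    (hv : |v| ≤ M) (hb : 0 ≤ b) (hbb : b ≤ X * a + |w| * c) (hK : K = (1 + 1 / ε) * L ^ 2 + M) :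
    (1 - ε) * (b ^ 2 - E * (X * w) ^ 2 + (1 - ε)⁻¹ * v * (X * w) ^ 2) + ε ^ 2 * a ^ 2
      - K * w ^ 2 ≤ a ^ 2 - E * w ^ 2 + v * w ^ 2 := by
  obtain ⟨h0, h1⟩ := hε
  have hne : (1 - ε) ≠ 0 := by linarith
  have e1 : (1 - ε) * (b ^ 2 - E * (X * w) ^ 2 + (1 - ε)⁻¹ * v * (X * w) ^ 2)
      = (1 - ε) * b ^ 2 - (1 - ε) * E * X ^ 2 * w ^ 2 + v * X ^ 2 * w ^ 2 := by
    field_simp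
  have hX2 : X ^ 2 ≤ 1 := pow_le_one₀ hX0 hX1
  have hb2 : b ^ 2 ≤ (1 + ε) * a ^ 2 + (1 + 1 / ε) * (L ^ 2 * w ^ 2) := by
    have s1 : b ≤ a + |w| * L := by
      have : X * a ≤ a := by nlinarith
      have : |w| * c ≤ |w| * L := mul_le_mul_of_nonneg_left hcL (abs_nonneg _)
      linarith
    have s2 : b ^ 2 ≤ (a + |w| * L) ^ 2 := pow_le_pow_left₀ hb s1 2
    have s3 : (|w| * L) ^ 2 = L ^ 2 * w ^ 2 := by rw [mul_pow, sq_abs]; ring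
    have s4 : 2 * a * (|w| * L) ≤ ε * a ^ 2 + 1 / ε * (|w| * L) ^ 2 := by
      have : 0 ≤ (1 / ε) * (ε * a - |w| * L) ^ 2 := by positivity
      have e : (1 / ε) * (ε * a - |w| * L) ^ 2
        = ε * a ^ 2 + 1 / ε * (|w| * L) ^ 2 - 2 * a * (|w| * L) := by
        field_simp
        ring
      linarith
    rw [← s3]
    nlinarith
  have hL2 : 0 ≤ (1 + 1 / ε) * (L ^ 2 * w ^ 2) := by positivity
  have t1 : (1 - ε) * b ^ 2 ≤ (1 - ε ^ 2) * a ^ 2 + (1 + 1 / ε) * (L ^ 2 * w ^ 2) := by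
    have := mul_le_mul_of_nonneg_left hb2 (by linarith : 0 ≤ 1 - ε)
    nlinarith
  have t2 : - ((1 - ε) * E * X ^ 2 * w ^ 2) ≤ - E * w ^ 2 := by
    have q : (1 - ε) * X ^ 2 ≤ 1 := by nlinarith [sq_nonneg X]
    have : 0 ≤ (-E) * w ^ 2 := mul_nonneg (by linarith) (sq_nonneg _)
    nlinarith
  have t3 : v * X ^ 2 * w ^ 2 ≤ v * w ^ 2 + M * w ^ 2 := by
    have q : - M ≤ v := (abs_le.1 hv).1
    have q' : 0 ≤ (1 - X ^ 2) * w ^ 2 := mul_nonneg (by linarith) (sq_nonneg _)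
    have q3 : 0 ≤ M := (abs_nonneg _).trans hv
    have q4 : 0 ≤ X ^ 2 * w ^ 2 * M := by positivity
    nlinarith
  rw [e1, hK]
  nlinarith

lemma form_compare {d : ℕ} (R : ℝ) (hR : 0 < R) (V : Ed d → ℝ) (hVmeas : Measurable V) (M : ℝ)
    (hVbd : ∀ x, |V x| ≤ M) (ε : ℝ) (hε : ε ∈ Set.Ioo (0:ℝ) 1) (E : ℝ) (hE : E < 0)
    (χ : Ed d → ℝ) (hχ : ContDiff ℝ 1 χ) (hχ0 : ∀ x, 0 ≤ χ x) (hχ1 : ∀ x, χ x ≤ 1)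
    (hχf : ∀ x, 2 * R < ‖x‖ → χ x = 1) (hχd : ∀ x, 2 * R < ‖x‖ → fderiv ℝ χ x = 0)
    (L : ℝ) (hL : ∀ x, ‖fderiv ℝ χ x‖ ≤ L)
    (K : ℝ) (hK : K = (1 + 1 / ε) * L ^ 2 + M)
    (u : Ed d → ℝ) (hu : ContDiff ℝ 1 u) (hcs : HasCompactSupport u)
    (hP : K * ∫ x in {x : Ed d | R < ‖x‖ ∧ ‖x‖ ≤ 2 * R}, u x ^ 2 ≤
        ε ^ 2 * ∫ x in {x : Ed d | R < ‖x‖}, ‖fderiv ℝ u x‖ ^ 2) :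
    (1 - ε) * (∫ x in {x : Ed d | R < ‖x‖}, (‖gradient (χ * u) x‖ ^ 2 - E * (χ * u) x ^ 2
      + ((1 - ε)⁻¹ * V x) * (χ * u) x ^ 2)) ≤
    ∫ x in {x : Ed d | R < ‖x‖}, (‖gradient u x‖ ^ 2 - E * u x ^ 2 + V x * u x ^ 2) := by
  have hme : MeasurableSet {x : Ed d | R < ‖x‖} := measurableSet_lt measurable_const measurable_norm
  have hmi : MeasurableSet {x : Ed d | ‖x‖ ≤ 2 * R} :=
    measurableSet_le measurable_norm measurable_const
  have i1 : IntegrableOn (fun x => ‖gradient u x‖ ^ 2 - E * u x ^ 2 + V x * u x ^ 2)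
      {x : Ed d | R < ‖x‖} := (integrable_form_aux u hu hcs V hVmeas M hVbd E).integrableOn
  have i2 : IntegrableOn (fun x => ‖gradient (χ * u) x‖ ^ 2 - E * (χ * u) x ^ 2
      + ((1 - ε)⁻¹ * V x) * (χ * u) x ^ 2) {x : Ed d | R < ‖x‖} := by
    refine (integrable_form_aux (χ * u) (hχ.mul hu) hcs.mul_left (fun x => (1 - ε)⁻¹ * V x)
      (hVmeas.const_mul _) (|(1 - ε)⁻¹| * M) ?_ E).integrableOn
    intro x
    rw [abs_mul]
    gcongr
    exact hVbd x
  have i3 : IntegrableOn (fun x => ‖fderiv ℝ u x‖ ^ 2) {x : Ed d | R < ‖x‖} :=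
    (integrable_fderiv_sq_aux u hu hcs).integrableOn
  have i4 : IntegrableOn (indicator {x : Ed d | ‖x‖ ≤ 2 * R} (fun x => u x ^ 2))
      {x : Ed d | R < ‖x‖} :=
    ((integrable_sq_aux u hu.continuous hcs).indicator hmi).integrableOn
  have e4 : ∫ x in {x : Ed d | R < ‖x‖}, indicator {x : Ed d | ‖x‖ ≤ 2 * R} (fun x => u x ^ 2) x
      = ∫ x in {x : Ed d | R < ‖x‖ ∧ ‖x‖ ≤ 2 * R}, u x ^ 2 := by
    rw [setIntegral_indicator hmi]
    rfl
  have key : ∫ x in {x : Ed d | R < ‖x‖}, (((1 - ε) * (‖gradient (χ * u) x‖ ^ 2 - E * (χ * u) x ^ 2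
      + ((1 - ε)⁻¹ * V x) * (χ * u) x ^ 2) + ε ^ 2 * ‖fderiv ℝ u x‖ ^ 2) -
      K * indicator {x : Ed d | ‖x‖ ≤ 2 * R} (fun x => u x ^ 2) x) ≤
      ∫ x in {x : Ed d | R < ‖x‖}, (‖gradient u x‖ ^ 2 - E * u x ^ 2 + V x * u x ^ 2) := by
    refine setIntegral_mono_on (((i2.const_mul _).add (i3.const_mul _)).sub (i4.const_mul _))
      i1 hme ?_
    intro x hx
    have hfd : fderiv ℝ (χ * u) x = χ x • fderiv ℝ u x + u x • fderiv ℝ χ x :=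
      fderiv_mul (hχ.differentiable (by norm_num) x) (hu.differentiable (by norm_num) x)
    have hn : ‖fderiv ℝ (χ * u) x‖ ≤ χ x * ‖fderiv ℝ u x‖ + |u x| * ‖fderiv ℝ χ x‖ := by
      rw [hfd]
      refine (norm_add_le _ _).trans ?_
      rw [norm_smul, norm_smul, Real.norm_eq_abs, Real.norm_eq_abs, abs_of_nonneg (hχ0 x)]
    rw [norm_gradient_aux, norm_gradient_aux]
    by_cases h : ‖x‖ ≤ 2 * R
    · rw [indicator_of_mem (by exact h)]
      exact pointwise_aux ε K L M _ _ _ (χ x) (V x) E (u x) hε hE (norm_nonneg _) (norm_nonneg _)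
        (hL x) (hχ0 x) (hχ1 x) (hVbd x) (norm_nonneg _) hn hK
    · rw [indicator_of_notMem (by exact h)]
      push Not at h
      rw [hχd x h, hχf x h] at hfd
      have e1 : (χ * u) x = u x := by simp [hχf x h]
      rw [hfd, e1]
      have hne : (1 - ε) ≠ 0 := by linarith [hε.2]
      have e2 : (1 - ε) * (‖(1:ℝ) • fderiv ℝ u x + u x • (0 : Ed d →L[ℝ] ℝ)‖ ^ 2 - E * u x ^ 2 +
          (1 - ε)⁻¹ * V x * u x ^ 2)
          = (1 - ε) * ‖fderiv ℝ u x‖ ^ 2 - (1 - ε) * E * u x ^ 2 + V x * u x ^ 2 := by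
        simp only [one_smul, smul_zero, add_zero]
        field_simp
      rw [e2]
      have q1 : 0 ≤ (ε - ε ^ 2) * ‖fderiv ℝ u x‖ ^ 2 :=
        mul_nonneg (by nlinarith [hε.1, hε.2]) (sq_nonneg _)
      have q2 : 0 ≤ ε * (-E) * u x ^ 2 :=
        mul_nonneg (mul_nonneg hε.1.le (by linarith)) (sq_nonneg _)
      nlinarith
  rw [integral_sub (by exact (i2.const_mul _).add (i3.const_mul _)) (i4.const_mul _),
    integral_add (i2.const_mul _) (i3.const_mul _), integral_const_mul, integral_const_mul,
    integral_const_mul, e4] at key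
  linarith

lemma exists_cutoff (d : ℕ) (R : ℝ) (hR : 0 < R) : ∃ χ : Ed d → ℝ, ContDiff ℝ (⊤ : ℕ∞) χ ∧
    (∀ x, 0 ≤ χ x) ∧ (∀ x, χ x ≤ 1) ∧ (∀ x, 2 * R < ‖x‖ → χ x = 1) ∧
    (∀ x, 2 * R < ‖x‖ → fderiv ℝ χ x = 0) ∧ (∃ L, ∀ x, ‖fderiv ℝ χ x‖ ≤ L) ∧
    tsupport χ ⊆ {x : Ed d | R < ‖x‖} := by
  let f : ContDiffBump (0 : Ed d) := ⟨5 / 4 * R, 2 * R, by positivity, by linarith⟩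
  have hfd : ∀ x, fderiv ℝ (fun x => 1 - f x) x = - fderiv ℝ f x := fun x => by
    rw [fderiv_const_sub]
  refine ⟨fun x => 1 - f x, contDiff_const.sub f.contDiff, fun x => by linarith [f.le_one (x := x)],
    fun x => by linarith [f.nonneg (x := x)], ?_, ?_, ?_, ?_⟩
  · intro x hx
    have h : f x = 0 := f.zero_of_le_dist (by rw [dist_zero_right]; exact hx.le)
    simp [h]
  · intro x hx
    rw [hfd, neg_eq_zero]
    by_contra hne
    have h1 := support_fderiv_subset ℝ (f := f) hne
    rw [f.tsupport_eq, mem_closedBall_zero_iff] at h1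
    exact absurd hx (not_lt.2 h1)
  · obtain ⟨L, hL⟩ := (f.hasCompactSupport.fderiv ℝ).exists_bound_of_continuous
      ((f.contDiff (n := 1)).continuous_fderiv (by norm_num))
    exact ⟨L, fun x => by rw [hfd, norm_neg]; exact hL x⟩
  · have h1 : tsupport (fun x => 1 - f x) ⊆ {x : Ed d | 5 / 4 * R ≤ ‖x‖} := by
      apply closure_minimal _ (isClosed_le continuous_const continuous_norm)
      intro x hx
      by_contra h
      apply hx
      have : f x = 1 := f.one_of_mem_closedBall (by
        rw [mem_closedBall_zero_iff]; exact (not_le.1 h).le)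
      simp [this]
    intro x hx
    have : 5 / 4 * R ≤ ‖x‖ := h1 hx
    show R < ‖x‖
    linarith

/-- compactly supported smooth functions whose restriction lies in `F` -/
def liftSub (d : ℕ) (R : ℝ) (F : Submodule ℝ ({x : Ed d // R < ‖x‖} → ℝ)) :
    Submodule ℝ (Ed d → ℝ) where
  carrier := {u | ContDiff ℝ (⊤ : ℕ∞) u ∧ HasCompactSupport u ∧
    (fun x : {x : Ed d // R < ‖x‖} => u x.1) ∈ F}
  add_mem' := by
    rintro a b ⟨h1, h2, h3⟩ ⟨k1, k2, k3⟩
    exact ⟨h1.add k1, h2.add k2, F.add_mem h3 k3⟩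
  zero_mem' := ⟨contDiff_const, HasCompactSupport.zero, F.zero_mem⟩
  smul_mem' := by
    rintro c a ⟨h1, h2, h3⟩
    exact ⟨contDiff_const.smul h1, h2.smul_left (f := fun _ => c), F.smul_mem c h3⟩

/-- restriction map -/
def liftRes (d : ℕ) (R : ℝ) (F : Submodule ℝ ({x : Ed d // R < ‖x‖} → ℝ)) :
    liftSub d R F →ₗ[ℝ] F where
  toFun u := ⟨fun x => u.1 x.1, u.2.2.2⟩
  map_add' _ _ := rfl
  map_smul' _ _ := rfl

/-- averaging functionals -/
def avgMap (d : ℕ) (R : ℝ) (F : Submodule ℝ ({x : Ed d // R < ‖x‖} → ℝ)) (r : ℝ)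
    (T : Finset (Ed d)) : liftSub d R F →ₗ[ℝ] (T → ℝ) where
  toFun u c := ∫ y in Metric.ball c.1 r, u.1 y
  map_add' u v := by
    ext c
    exact integral_add (u.2.1.continuous.integrable_of_hasCompactSupport u.2.2.1).integrableOn
      (v.2.1.continuous.integrable_of_hasCompactSupport v.2.2.1).integrableOn
  map_smul' a u := by
    ext c
    exact integral_const_mul _ _

/-- multiplication by the cutoff -/
def cutMap (d : ℕ) (R : ℝ) (F : Submodule ℝ ({x : Ed d // R < ‖x‖} → ℝ)) (χ : Ed d → ℝ) :
    liftSub d R F →ₗ[ℝ] (Ed d → ℝ) where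
  toFun u := χ * u.1
  map_add' u v := mul_add _ _ _
  map_smul' a u := mul_smul_comm _ _ _

/-- Lemma 4.1: Neumann–Dirichlet comparison on the exterior domain `𝒪_R`. -/
theorem neumann_le_dirichlet_exterior_domain
    (d : ℕ) (hd : 1 ≤ d) (R : ℝ) (hR : 0 < R)
    (V : Ed d → ℝ) (hVmeas : Measurable V) (M : ℝ) (hVbd : ∀ x, |V x| ≤ M)
    (hV0 : Tendsto V (cocompact (Ed d)) (𝓝 0)) :
    ∀ ε ∈ Set.Ioo (0 : ℝ) 1, ∃ C : ℕ, ∃ E₀ : ℝ, E₀ < 0 ∧ ∀ E ∈ Set.Ioo E₀ (0 : ℝ),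
      nuNeu d R V E ≤ nuDir d R (fun x => (1 - ε)⁻¹ * V x) E + (C : ℕ∞) := by
  intro ε hε
  obtain ⟨χ, hχ, hχ0, hχ1, hχf, hχd, ⟨L, hL⟩, hχs⟩ := exists_cutoff d R hR
  set K := (1 + 1 / ε) * L ^ 2 + M with hK
  have hε0 := hε.1
  have hM : 0 ≤ M := (abs_nonneg _).trans (hVbd 0)
  have hK0 : 0 ≤ K := by positivity
  obtain ⟨r, T, hT⟩ := shell_poincare d R (ε ^ 2 / (K + 1)) hR (by positivity)
  refine ⟨T.card, -1, by norm_num, fun E hE => ?_⟩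
  unfold nuNeu
  apply iSup_le
  rintro ⟨F, hF1, hF2⟩
  show (Module.finrank ℝ F : ℕ∞) ≤ _
  by_cases hfin : Module.Finite ℝ F
  swap
  · rw [Module.finrank_of_not_finite hfin]
    simp
  -- linear lift of `F`
  have hsurj : LinearMap.range (liftRes d R F) = ⊤ := by
    rw [LinearMap.range_eq_top]
    rintro ⟨v, hv⟩
    obtain ⟨u, h1, h2, h3⟩ := hF1 v hv
    have e : (fun x : {x : Ed d // R < ‖x‖} => u x.1) = v := by
      ext x; exact (h3 x).symm
    exact ⟨⟨u, h1, h2, by rw [e]; exact hv⟩, Subtype.ext e⟩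
  obtain ⟨σ, hσ⟩ := (liftRes d R F).exists_rightInverse_of_surjective hsurj
  have hσ' : ∀ (v : F) (x : {x : Ed d // R < ‖x‖}), v.1 x = (σ v).1 x.1 := by
    intro v x
    have := LinearMap.congr_fun hσ v
    exact (congrFun (congrArg Subtype.val this) x).symm
  let ℓ : F →ₗ[ℝ] (T → ℝ) := (avgMap d R F r T).comp σ
  let τ : F →ₗ[ℝ] (Ed d → ℝ) := (cutMap d R F χ).comp σ
  have hneg : ∀ v : F, ℓ v = 0 → v ≠ 0 →
      (∫ x in {x : Ed d | R < ‖x‖}, (‖gradient (τ v) x‖ ^ 2 - E * (τ v) x ^ 2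
      + ((1 - ε)⁻¹ * V x) * (τ v) x ^ 2)) < 0 := by
    intro v hv hv0
    have hs : ContDiff ℝ (⊤ : ℕ∞) (σ v).1 := (σ v).2.1
    have hs1 : ContDiff ℝ 1 (σ v).1 := hs.of_le (by exact_mod_cast le_top)
    have hc : HasCompactSupport (σ v).1 := (σ v).2.2.1
    have hQ := hF2 v.1 v.2 (fun h => hv0 (Subtype.ext h)) (σ v).1 hs hc (hσ' v)
    have hPo := hT (σ v).1 hs1 hc (fun c hcT => congrFun hv ⟨c, hcT⟩)
    have hG : 0 ≤ ∫ x in {x : Ed d | R < ‖x‖}, ‖fderiv ℝ (σ v).1 x‖ ^ 2 :=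
      integral_nonneg fun y => by positivity
    have hP : K * ∫ x in {x : Ed d | R < ‖x‖ ∧ ‖x‖ ≤ 2 * R}, (σ v).1 x ^ 2 ≤
        ε ^ 2 * ∫ x in {x : Ed d | R < ‖x‖}, ‖fderiv ℝ (σ v).1 x‖ ^ 2 := by
      refine (mul_le_mul_of_nonneg_left hPo hK0).trans ?_
      rw [← mul_assoc]
      refine mul_le_mul_of_nonneg_right ?_ hG
      rw [mul_div_assoc', div_le_iff₀ (by positivity)]
      nlinarith [sq_nonneg ε]
    have := form_compare R hR V hVmeas M hVbd ε hε E hE.2 χ (hχ.of_le (by exact_mod_cast le_top))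
      hχ0 hχ1 hχf hχd L hL K hK (σ v).1 hs1 hc hP
    have h3 := this.trans_lt hQ
    have h4 : 0 < 1 - ε := by linarith [hε.2]
    by_contra hcon
    exact absurd h3 (not_lt.2 (mul_nonneg h4.le (not_lt.1 hcon)))
  have hinj : Function.Injective (τ.domRestrict (LinearMap.ker ℓ)) := by
    refine (injective_iff_map_eq_zero _).2 ?_
    rintro ⟨v, hv⟩ h
    by_contra hne
    have := hneg v hv (fun h => hne (Subtype.ext h))
    have h' : τ v = 0 := h
    rw [h'] at this
    have e : ∀ x : Ed d, gradient (0 : Ed d → ℝ) x = 0 := by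
      intro x
      simp [gradient]
    simp [e] at this
  have hrank : Module.finrank ℝ F ≤
      Module.finrank ℝ (LinearMap.range (τ.domRestrict (LinearMap.ker ℓ))) + T.card := by
    rw [LinearMap.finrank_range_of_inj hinj, ← ℓ.finrank_range_add_finrank_ker, add_comm]
    have : Module.finrank ℝ (LinearMap.range ℓ) ≤ T.card := by
      refine (Submodule.finrank_le _).trans ?_
      simp
    omega
  have hle : (Module.finrank ℝ (LinearMap.range (τ.domRestrict (LinearMap.ker ℓ))) : ℕ∞) ≤
      nuDir d R (fun x => (1 - ε)⁻¹ * V x) E := by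
    unfold nuDir
    refine le_iSup_of_le ⟨LinearMap.range (τ.domRestrict (LinearMap.ker ℓ)), ?_, ?_⟩ le_rfl
    · rintro _ ⟨v, rfl⟩
      refine ⟨hχ.mul (σ v.1).2.1, (σ v.1).2.2.1.mul_left, ?_⟩
      exact (tsupport_mul_subset_left).trans hχs
    · rintro _ ⟨v, rfl⟩ hne
      refine hneg v.1 v.2 ?_
      intro h
      apply hne
      show τ v.1 = 0
      rw [h, map_zero]
  calc (Module.finrank ℝ F : ℕ∞) ≤
      ((Module.finrank ℝ (LinearMap.range (τ.domRestrict (LinearMap.ker ℓ))) + T.card : ℕ) : ℕ∞) := by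
        exact_mod_cast hrank
    _ ≤ _ := by
        push_cast
        gcongr

end
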